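/- For every integer m ≥ 0 and every n ∈ ℤ, (i A*)^m ψ_{0,n} = (ν^m m!)^{1/2} ψ_{m,n}, where A* is the first-order operator (A* f)(z) = ν conj(z) f(z) − (∂f/∂z)(z) and (i A*)^m means m-fold application of the operator f ↦ i·(A* f). Here ψ_{0,n} = ψₙ is holomorphic and each ψ_{m,n} is smooth, so all the Wirtinger derivatives involved exist. -/

import Mathlib

open Complex

/-- The physicists' Hermite polynomials, defined by `H₀ = 1` and
`H_{m+1}(x) = 2x H_m(x) − H_m'(x)`. -/
noncomputable def physHermite : ℕ → Polynomial ℝ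
  | 0 => 1
  | m + 1 => 2 * Polynomial.X * physHermite m - Polynomial.derivative (physHermite m)

/-- `ψ_{m,n}(z) = (2^m m!)^{−1/2} (2ν/π)^{1/4} e^{−(π²/ν)(n+α)²}
e^{(ν/2)z² + 2πi(α+n)z} H_m(√(2ν) y + √(2/ν) π(n+α))`, where `z = x + iy`. -/
noncomputable def psiMN (α ν : ℝ) (m : ℕ) (n : ℤ) (z : ℂ) : ℂ :=
  ((((2 : ℝ) ^ m * Nat.factorial m) ^ (-(1 : ℝ) / 2) *
      (2 * ν / Real.pi) ^ ((1 : ℝ) / 4) *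
      Real.exp (-(Real.pi ^ 2 / ν) * (n + α) ^ 2) : ℝ) : ℂ) *
    Complex.exp (ν / 2 * z ^ 2 + 2 * Real.pi * Complex.I * (α + n) * z) *
    (((physHermite m).eval
        (Real.sqrt (2 * ν) * z.im + Real.sqrt (2 / ν) * Real.pi * (n + α)) : ℝ) : ℂ)

/-- The Wirtinger derivative `∂f/∂z = (1/2)(∂f/∂x − i ∂f/∂y)`, expressed via the real
Fréchet derivative. -/
noncomputable def wirtingerZ (f : ℂ → ℂ) (z : ℂ) : ℂ :=
  (1 / 2 : ℂ) * (fderiv ℝ f z 1 - Complex.I * fderiv ℝ f z Complex.I)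

/-- The creation operator `i A*` sends `K e^{(ν/2)z² + 2πicz} p(√(2ν) y + √(2/ν) πc)` to
`√(ν/2)` times the function of the same form with `p` replaced by `2Xp − p'`. -/
theorem creation_exp_mul_polynomial (ν : ℝ) (hν : 0 < ν) (c : ℝ) (K : ℂ) (p : Polynomial ℝ)
    (z : ℂ) :
    Complex.I * (ν * (starRingEnd ℂ) z *
        (K * Complex.exp (ν / 2 * z ^ 2 + 2 * Real.pi * Complex.I * c * z) *
          ((p.eval (Real.sqrt (2 * ν) * z.im + Real.sqrt (2 / ν) * Real.pi * c) : ℝ) : ℂ)) -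
      wirtingerZ (fun w : ℂ =>
        K * Complex.exp (ν / 2 * w ^ 2 + 2 * Real.pi * Complex.I * c * w) *
          ((p.eval (Real.sqrt (2 * ν) * w.im + Real.sqrt (2 / ν) * Real.pi * c) : ℝ) : ℂ)) z)
    = (Real.sqrt (ν / 2) : ℂ) * K *
        Complex.exp (ν / 2 * z ^ 2 + 2 * Real.pi * Complex.I * c * z) *
        (((2 * Polynomial.X * p - Polynomial.derivative p).eval
          (Real.sqrt (2 * ν) * z.im + Real.sqrt (2 / ν) * Real.pi * c) : ℝ) : ℂ) := by
  have hexp : HasDerivAt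
      (fun w : ℂ => K * Complex.exp (ν / 2 * w ^ 2 + 2 * Real.pi * Complex.I * c * w))
      (K * (Complex.exp (ν / 2 * z ^ 2 + 2 * Real.pi * Complex.I * c * z) *
        (ν * z + 2 * Real.pi * Complex.I * c))) z := by
    have hquad : HasDerivAt
        (fun w : ℂ => (ν : ℂ) / 2 * w ^ 2 + 2 * Real.pi * Complex.I * c * w)
        (ν * z + 2 * Real.pi * Complex.I * c) z := by
      refine (((hasDerivAt_pow 2 z).const_mul ((ν : ℂ) / 2)).add
        ((hasDerivAt_id z).const_mul (2 * Real.pi * Complex.I * c))).congr_deriv ?_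
      push_cast
      ring
    exact hquad.cexp.const_mul K
  have harg : HasFDerivAt
      (fun w : ℂ => Real.sqrt (2 * ν) * w.im + Real.sqrt (2 / ν) * Real.pi * c)
      (Real.sqrt (2 * ν) • Complex.imCLM) z :=
    (Complex.imCLM.hasFDerivAt.const_mul _).add_const _
  have hpoly := Complex.ofRealCLM.hasFDerivAt.comp z
    ((p.hasDerivAt _).comp_hasFDerivAt z harg)
  have hprod := (hexp.hasFDerivAt.restrictScalars ℝ).fun_mul hpoly
  simp only [Function.comp_apply, Complex.ofRealCLM_apply] at hprod
  have hsqrt_two_mul : Real.sqrt (2 * ν) = 2 * Real.sqrt (ν / 2) := by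
    rw [show 2 * ν = 2 ^ 2 * (ν / 2) by ring, Real.sqrt_mul (by positivity),
      Real.sqrt_sq (by norm_num)]
  have hsqrt_mul_sqrt : Real.sqrt (ν / 2) * Real.sqrt (2 / ν) = 1 := by
    rw [← Real.sqrt_mul (by positivity), show ν / 2 * (2 / ν) = 1 by field_simp, Real.sqrt_one]
  have hsq : (Real.sqrt (ν / 2) : ℂ) ^ 2 = ν / 2 := by
    exact_mod_cast Real.sq_sqrt (show 0 ≤ ν / 2 by positivity)
  have hmul : (Real.sqrt (ν / 2) : ℂ) * (Real.sqrt (2 / ν) : ℂ) = 1 := by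
    exact_mod_cast hsqrt_mul_sqrt
  have hconj : (starRingEnd ℂ) z = z - 2 * Complex.I * z.im := by
    apply Complex.ext <;> simp
    ring
  unfold wirtingerZ
  rw [hprod.fderiv, hconj]
  simp only [hsqrt_two_mul]
  generalize Real.sqrt (ν / 2) = a at *
  generalize Real.sqrt (2 / ν) = b at *
  generalize Complex.exp _ = E
  simp
  generalize (Polynomial.eval _ p) = P
  generalize (Polynomial.eval _ (Polynomial.derivative p)) = Q
  linear_combination 2 * K * E * P * (-2 * z.im * hsq - Real.pi * c * hmul) +
    K * E * (-2 * ν * z.im * P + Q * a + Complex.I / 2 * P * (ν * z + 2 * Real.pi * Complex.I * c) -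
      2 * Real.pi * c * P) * Complex.I_sq

/-- For every `m ≥ 0` and `n ∈ ℤ`, `(i A*)^m ψ_{0,n} = (ν^m m!)^{1/2} ψ_{m,n}`,
where `(A* f)(z) = ν conj(z) f(z) − (∂f/∂z)(z)`. -/
theorem stmt_18 (α ν : ℝ) (hν : 0 < ν) (m : ℕ) (n : ℤ) :
    ∀ z : ℂ,
      ((fun g : ℂ → ℂ => fun w : ℂ =>
          Complex.I * (ν * (starRingEnd ℂ) w * g w - wirtingerZ g w))^[m]
        (psiMN α ν 0 n)) z
      = ((Real.sqrt (ν ^ m * Nat.factorial m) : ℝ) : ℂ) * psiMN α ν m n z := by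
  set K : ℂ := (((2 * ν / Real.pi) ^ ((1 : ℝ) / 4) *
      Real.exp (-(Real.pi ^ 2 / ν) * (n + α) ^ 2) : ℝ) : ℂ) with hK
  have hiter : ((fun g : ℂ → ℂ => fun w : ℂ =>
          Complex.I * (ν * (starRingEnd ℂ) w * g w - wirtingerZ g w))^[m] (psiMN α ν 0 n))
      = fun w : ℂ => (Real.sqrt (ν / 2) : ℂ) ^ m * K *
          Complex.exp (ν / 2 * w ^ 2 + 2 * Real.pi * Complex.I * ((n + α : ℝ) : ℂ) * w) *
          (((physHermite m).eval
            (Real.sqrt (2 * ν) * w.im + Real.sqrt (2 / ν) * Real.pi * (n + α)) : ℝ) : ℂ) := by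
    induction m with
    | zero =>
      funext w
      simp [psiMN, hK, add_comm]
    | succ m ih =>
      rw [Function.iterate_succ_apply', ih]
      funext w
      rw [creation_exp_mul_polynomial ν hν (n + α), physHermite]
      ring
  have hnorm : Real.sqrt (ν ^ m * Nat.factorial m) *
      ((2 : ℝ) ^ m * Nat.factorial m) ^ (-(1 : ℝ) / 2) = Real.sqrt (ν / 2) ^ m := by
    rw [neg_div, Real.rpow_neg (by positivity), ← Real.sqrt_eq_rpow, ← Real.sqrt_inv,
      ← Real.sqrt_mul (by positivity), ← Real.sqrt_sq (pow_nonneg (Real.sqrt_nonneg (ν / 2)) m),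
      pow_right_comm, Real.sq_sqrt (by positivity)]
    congr 1
    rw [div_pow]
    field_simp
  intro z
  rw [hiter, psiMN, ← ofReal_pow, ← hnorm, hK]
  push_cast
  ring_nf
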